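/- The Löwenheim number ℓ_I of the Härtig quantifier logic L^I has cofinality ω and is a fixed point of the aleph function: ℓ_I = ℵ_{ℓ_I}. -/

import Mathlib

open Cardinal

/-- Formulas of the Härtig quantifier logic `L^I`, over the canonical countable
purely relational vocabulary in which, for each natural number `r`, there is a
relation symbol `r` that may be applied to any finite list of variables (so the
arity is determined by the application).  Variables are indexed by natural
numbers.  Since every sentence mentions only finitely many symbols, validity,
satisfiability, the Löwenheim number etc. for `L^I` over arbitrary vocabularies
coincide with the corresponding notions for this canonical vocabulary. -/
inductive HForm : Type where
  | falsum : HForm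
  | eq : ℕ → ℕ → HForm
  | rel : ℕ → List ℕ → HForm
  | imp : HForm → HForm → HForm
  | all : ℕ → HForm → HForm
  /-- `hartig i j φ ψ` is the Härtig (equicardinality) quantifier
  `I xᵢ xⱼ φ(xᵢ) ψ(xⱼ)`. -/
  | hartig : ℕ → ℕ → HForm → HForm → HForm

namespace HForm

/-- The free variables of an `L^I`-formula. -/
def freeVars : HForm → Finset ℕ
  | falsum => ∅
  | eq i j => {i, j}
  | rel _ l => l.toFinset
  | imp f g => f.freeVars ∪ g.freeVars
  | all i f => f.freeVars \ {i}
  | hartig i j f g => (f.freeVars \ {i}) ∪ (g.freeVars \ {j})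

/-- A sentence is a formula with no free variables. -/
def IsSentence (φ : HForm) : Prop := φ.freeVars = ∅

end HForm

/-- An interpretation of the canonical relational vocabulary on a domain `M`:
each relation symbol `r` is interpreted as a predicate on finite tuples. -/
def Interp (M : Type u) : Type u := ℕ → List M → Prop

/-- Satisfaction for the Härtig quantifier logic `L^I`: `HSat R φ v` says that
the structure `(M, R)` satisfies `φ` under the valuation `v`.  The clause for
the Härtig quantifier `I xᵢ xⱼ φ ψ` says exactly
`|{a : φ(a)}| = |{a : ψ(a)}|`. -/
def HSat {M : Type u} (R : Interp M) : HForm → (ℕ → M) → Prop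
  | .falsum, _ => False
  | .eq i j, v => v i = v j
  | .rel r l, v => R r (l.map v)
  | .imp f g, v => HSat R f v → HSat R g v
  | .all i f, v => ∀ a : M, HSat R f (Function.update v i a)
  | .hartig i j f g, v =>
      #{a : M // HSat R f (Function.update v i a)} =
      #{a : M // HSat R g (Function.update v j a)}

/-- `φ` holds in the structure `(M, R)`. -/
def HModels (M : Type u) (R : Interp M) (φ : HForm) : Prop :=
  ∀ v : ℕ → M, HSat R φ v

/-- `φ` has a model (models are nonempty structures). -/
def HSatisfiable (φ : HForm) : Prop :=
  ∃ (M : Type) (_ : Nonempty M) (R : Interp M), HModels M R φ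

/-- `φ` is valid: it holds in every (nonempty) structure. -/
def HValid (φ : HForm) : Prop :=
  ∀ (M : Type) (_ : Nonempty M) (R : Interp M), HModels M R φ

/-- `κ` is a Löwenheim bound for `L^I`: every satisfiable `L^I`-sentence has a
model of cardinality at most `κ`. -/
def LoewenheimBound (κ : Cardinal.{0}) : Prop :=
  ∀ φ : HForm, φ.IsSentence → HSatisfiable φ →
    ∃ (M : Type) (_ : Nonempty M) (R : Interp M), #M ≤ κ ∧ HModels M R φ

/-- The Löwenheim number `ℓ_I` of the Härtig quantifier logic `L^I`: the least
cardinal `κ` such that every `L^I`-sentence having a model has a model of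
cardinality `≤ κ`. -/
noncomputable def ellI : Cardinal := sInf {κ : Cardinal | LoewenheimBound κ}


namespace HForm

/-- A numerical code for formulas. -/
def code : HForm → ℕ
  | falsum => Nat.pair 0 0
  | eq i j => Nat.pair 1 (Nat.pair i j)
  | rel r l => Nat.pair 2 (Nat.pair r (Encodable.encode l))
  | imp f g => Nat.pair 3 (Nat.pair f.code g.code)
  | all i f => Nat.pair 4 (Nat.pair i f.code)
  | hartig i j f g => Nat.pair 5 (Nat.pair (Nat.pair i j) (Nat.pair f.code g.code))

theorem code_injective : Function.Injective code := by
  intro f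
  induction f with
  | falsum => intro g h; cases g <;> simp_all [code, Nat.pair_eq_pair]
  | eq i j => intro g h; cases g <;> simp_all [code, Nat.pair_eq_pair]
  | rel r l => intro g h; cases g <;> simp_all [code, Nat.pair_eq_pair]
  | imp a b iha ihb =>
    intro g h
    cases g <;> simp only [code, Nat.pair_eq_pair] at h <;> try (exfalso; omega)
    rw [iha h.2.1, ihb h.2.2]
  | all i a iha =>
    intro g h
    cases g <;> simp only [code, Nat.pair_eq_pair] at h <;> try (exfalso; omega)
    rw [iha h.2.2, h.2.1]
  | hartig i j a b iha ihb =>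
    intro g h
    cases g <;> simp only [code, Nat.pair_eq_pair] at h <;> try (exfalso; omega)
    rw [iha h.2.2.1, ihb h.2.2.2, h.2.1.1, h.2.1.2]

instance : Countable HForm := code_injective.countable

/-- Negation. -/
def neg (f : HForm) : HForm := f.imp falsum

/-- Conjunction. -/
def and (f g : HForm) : HForm := (f.imp g.neg).neg

/-- The formula `P(xᵢ)`, where `P` is the relation symbol `0`. -/
def dom (i : ℕ) : HForm := rel 0 [i]

/-- The relativization of a formula to the predicate `P`, with the relation symbols of the formula
shifted so as to make room for two new ones. -/
def relativize : HForm → HForm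
  | falsum => falsum
  | eq i j => eq i j
  | rel r l => rel (r + 2) l
  | imp f g => f.relativize.imp g.relativize
  | all i f => all i ((dom i).imp f.relativize)
  | hartig i j f g => hartig i j ((dom i).and f.relativize) ((dom j).and g.relativize)

theorem freeVars_relativize (f : HForm) : f.relativize.freeVars = f.freeVars := by
  induction f with
  | falsum | eq | rel => rfl
  | imp f g ihf ihg => simp [relativize, freeVars, ihf, ihg]
  | all i f ih => ext; simp [relativize, freeVars, dom, ih]; grind
  | hartig i j f g ihf ihg =>
    ext; simp [relativize, freeVars, dom, and, neg, ihf, ihg]; grind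

/-- The predicate `P` is nonempty. -/
def domNonempty : HForm := (all 0 (dom 0).neg).neg

/-- The predicate `P` is not equinumerous with the universe. -/
def domSmall : HForm := (hartig 0 0 (dom 0) (eq 0 0)).neg

/-- The fibres of the relation symbol `1` over distinct elements of `P` have distinct
cardinalities. -/
def fibresDistinct : HForm :=
  all 0 (all 1 ((dom 0).imp ((dom 1).imp
    ((hartig 2 2 (rel 1 [0, 2]) (rel 1 [1, 2])).imp (eq 0 1)))))

/-- The predicate `P` carries a model of `f`, is smaller than the universe, and injects into the
cardinals below that of the universe. -/
def jump (f : HForm) : HForm :=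
  f.relativize.and (domNonempty.and (domSmall.and fibresDistinct))

theorem IsSentence.jump {f : HForm} (hf : f.IsSentence) : f.jump.IsSentence := by
  unfold IsSentence at *
  simp only [HForm.jump, HForm.and, neg, freeVars, freeVars_relativize, hf]
  decide

/-- A sentence which says that the universe is infinite: it is equinumerous with the complement of
each of its points. -/
def infinite : HForm := all 1 (hartig 0 0 (eq 0 1).neg (eq 0 0))

theorem isSentence_infinite : infinite.IsSentence := by
  unfold IsSentence; decide

end HForm

open HForm

section Semantics

variable {M : Type u} {R : Interp M}

theorem HSat_and {f g : HForm} {v : ℕ → M} : HSat R (f.and g) v ↔ HSat R f v ∧ HSat R g v := by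
  simp [HForm.and, HForm.neg, HSat]

theorem HSat_congr (f : HForm) {v w : ℕ → M} (h : ∀ i ∈ f.freeVars, v i = w i) :
    HSat R f v ↔ HSat R f w := by
  induction f generalizing v w with
  | falsum => rfl
  | eq i j => simp [HSat, h i (by simp [freeVars]), h j (by simp [freeVars])]
  | rel r l =>
    have : l.map v = l.map w := List.map_congr_left fun i hi => h i (by simpa [freeVars] using hi)
    simp [HSat, this]
  | imp f g ihf ihg =>
    simp only [HSat]
    rw [ihf fun i hi => h i (by simp [freeVars, hi]), ihg fun i hi => h i (by simp [freeVars, hi])]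
  | all i f ih =>
    refine forall_congr' fun a => ih fun k hk => ?_
    by_cases hki : k = i
    · simp [hki]
    · simp [hki, h k (by simp [freeVars, hk, hki])]
  | hartig i j f g ihf ihg =>
    have h₁ : ∀ a, HSat R f (Function.update v i a) ↔ HSat R f (Function.update w i a) := by
      refine fun a => ihf fun k hk => ?_
      by_cases hki : k = i
      · simp [hki]
      · simp [hki, h k (by simp [freeVars, hk, hki])]
    have h₂ : ∀ a, HSat R g (Function.update v j a) ↔ HSat R g (Function.update w j a) := by
      refine fun a => ihg fun k hk => ?_
      by_cases hkj : k = j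
      · simp [hkj]
      · simp [hkj, h k (by simp [freeVars, hk, hkj])]
    simp only [HSat, h₁, h₂]

theorem HModels.of_HSat {f : HForm} (hf : f.IsSentence) {v : ℕ → M} (h : HSat R f v) :
    HModels M R f :=
  fun _ => (HSat_congr f fun i hi => by
    rw [show f.freeVars = ∅ from hf] at hi
    exact absurd hi (Finset.notMem_empty i)).1 h

theorem HSat_relativize {N : Type u} {S : Interp N} (e : N ↪ M)
    (hdom : ∀ a, R 0 [a] ↔ a ∈ Set.range e) (hrel : ∀ r l, R (r + 2) (l.map e) ↔ S r l)
    (f : HForm) (v : ℕ → N) : HSat R f.relativize (e ∘ v) ↔ HSat S f v := by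
  have key : ∀ (g : HForm), (∀ v : ℕ → N, HSat R g.relativize (e ∘ v) ↔ HSat S g v) →
      ∀ (v : ℕ → N) (i : ℕ),
      #{a : M // HSat R ((dom i).and g.relativize) (Function.update (e ∘ v) i a)} =
      #{a : N // HSat S g (Function.update v i a)} := by
    intro g ih v i
    symm
    refine Cardinal.mk_congr (Equiv.ofBijective
      (fun a => ⟨e a.1, HSat_and.2 ⟨?_, ?_⟩⟩) ⟨?_, ?_⟩)
    · simp [dom, HSat, hdom]
    · rw [← Function.comp_update]
      exact (ih _).2 a.2
    · intro a b hab
      exact Subtype.ext (e.injective (congrArg Subtype.val hab))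
    · rintro ⟨a, ha⟩
      obtain ⟨h₁, h₂⟩ := HSat_and.1 ha
      obtain ⟨n, rfl⟩ : a ∈ Set.range e := by simpa [dom, HSat, hdom] using h₁
      rw [← Function.comp_update] at h₂
      exact ⟨⟨n, (ih _).1 h₂⟩, rfl⟩
  induction f generalizing v with
  | falsum => rfl
  | eq i j => simp [relativize, HSat]
  | rel r l => simp only [relativize, HSat, ← List.map_map, hrel]
  | imp f g ihf ihg => simp only [relativize, HSat, ihf, ihg]
  | all i f ih =>
    simp only [relativize, HSat]
    constructor
    · intro h n
      refine (ih _).1 ?_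
      rw [Function.comp_update]
      exact h (e n) (by simp [dom, HSat, hdom])
    · intro h a ha
      obtain ⟨n, rfl⟩ : a ∈ Set.range e := by simpa [dom, HSat, hdom] using ha
      rw [← Function.comp_update]
      exact (ih _).2 (h n)
  | hartig i j f g ihf ihg =>
    simp only [relativize, HSat]
    rw [key f ihf, key g ihg]

theorem HSat_domNonempty {v : ℕ → M} : HSat R domNonempty v ↔ ∃ a, R 0 [a] := by
  simp [domNonempty, HForm.neg, HSat, dom]

theorem HSat_domSmall {v : ℕ → M} : HSat R domSmall v ↔ #{a // R 0 [a]} ≠ #M := by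
  have : #{_a : M // True} = #M := Cardinal.mk_congr (Equiv.subtypeUnivEquiv fun _ => trivial)
  simp [domSmall, HForm.neg, HSat, dom, this]

theorem HSat_fibresDistinct {v : ℕ → M} : HSat R fibresDistinct v ↔
    ∀ a b, R 0 [a] → R 0 [b] → #{x // R 1 [a, x]} = #{x // R 1 [b, x]} → a = b := by
  simp [fibresDistinct, HSat, dom]

theorem HSat_infinite {v : ℕ → M} : HSat R HForm.infinite v ↔ ∀ b : M, #{a // a ≠ b} = #M := by
  have : #{_a : M // True} = #M := Cardinal.mk_congr (Equiv.subtypeUnivEquiv fun _ => trivial)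
  simp [HForm.infinite, HForm.neg, HSat, this]

end Semantics

theorem HModels_infinite_iff {M : Type} [Nonempty M] {R : Interp M} :
    HModels M R HForm.infinite ↔ ℵ₀ ≤ #M := by
  have hM (b : M) : #{a // a ≠ b} + 1 = #M := by
    have := Cardinal.mk_sum_compl ({b}ᶜ : Set M)
    rwa [compl_compl, Cardinal.mk_singleton] at this
  constructor
  · intro h
    obtain ⟨b⟩ := ‹Nonempty M›
    by_contra! hlt
    have hb := hM b
    rw [HSat_infinite.1 (h fun _ => b) b] at hb
    obtain ⟨n, hn⟩ := Cardinal.lt_aleph0.1 hlt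
    rw [hn] at hb
    exact n.succ_ne_self (by exact_mod_cast hb)
  · intro h v
    refine HSat_infinite.2 fun b => ?_
    have hb := hM b
    have : ℵ₀ ≤ #{a // a ≠ b} := by
      by_contra! hlt
      exact absurd (hb ▸ Cardinal.add_lt_aleph0 hlt Cardinal.one_lt_aleph0) h.not_gt
    rwa [Cardinal.add_one_eq this] at hb

theorem HSatisfiable_infinite : HSatisfiable HForm.infinite :=
  ⟨ℕ, inferInstance, fun _ _ => True, HModels_infinite_iff.2 (by simp)⟩

/-- The least cardinality of a model of `f`. -/
noncomputable def minCard (f : HForm) : Cardinal.{0} :=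
  sInf {c | ∃ (M : Type) (_ : Nonempty M) (R : Interp M), #M = c ∧ HModels M R f}

theorem minCard_le {f : HForm} {M : Type} [Nonempty M] {R : Interp M} (h : HModels M R f) :
    minCard f ≤ #M :=
  csInf_le' ⟨M, ‹_›, R, rfl, h⟩

theorem exists_model_minCard {f : HForm} (h : HSatisfiable f) :
    ∃ (M : Type) (_ : Nonempty M) (R : Interp M), #M = minCard f ∧ HModels M R f := by
  obtain ⟨M, hM, R, h⟩ := h
  exact csInf_mem (s := {c | ∃ (M : Type) (_ : Nonempty M) (R : Interp M),
    #M = c ∧ HModels M R f}) ⟨#M, M, hM, R, rfl, h⟩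

theorem HSatisfiable.jump {f : HForm} (hf : f.IsSentence) (h : HSatisfiable f) :
    HSatisfiable f.jump := by
  obtain ⟨N, ⟨n₀⟩, S, hS⟩ := h
  let c : N → Cardinal := fun n => preAleph (Ordinal.typein (WellOrderingRel (α := N)) n)
  have hc : Function.Injective c := fun a b hab =>
    Ordinal.typein_injective WellOrderingRel (preAleph.injective hab)
  let κ : Cardinal.{0} :=
    Order.succ (max (preAleph (Ordinal.type (WellOrderingRel (α := N)))) #N)
  have hcκ (n : N) : c n ≤ #κ.out := by
    rw [Cardinal.mk_out]
    exact (preAleph_le_preAleph.2 (Ordinal.typein_lt_type _ n).le).trans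
      ((le_max_left _ _).trans (Order.le_succ _))
  choose s hs using fun n => Cardinal.le_mk_iff_exists_set.1 (hcκ n)
  let R : Interp (N ⊕ κ.out) := fun
    | 0, l => ∃ n, l = [Sum.inl n]
    | 1, l => ∃ n, ∃ q ∈ s n, l = [Sum.inl n, Sum.inr q]
    | r + 2, l => ∃ l' : List N, l = l'.map Sum.inl ∧ S r l'
  have hP : ∀ a, R 0 [a] ↔ a ∈ Set.range (Function.Embedding.inl : N ↪ N ⊕ κ.out) := by
    intro a
    simp [R, eq_comm]
  have hrel : ∀ r l, R (r + 2) (l.map (Function.Embedding.inl : N ↪ N ⊕ κ.out)) ↔ S r l := by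
    intro r l
    constructor
    · rintro ⟨l', hl, hl'⟩
      rwa [List.map_injective_iff.2 Sum.inl_injective hl]
    · exact fun h => ⟨l, rfl, h⟩
  refine ⟨N ⊕ κ.out, ⟨.inl n₀⟩, R, HModels.of_HSat hf.jump
    (v := Function.Embedding.inl ∘ fun _ => n₀) ?_⟩
  refine HSat_and.2 ⟨(HSat_relativize _ hP hrel f _).2 (hS _), HSat_and.2 ⟨HSat_domNonempty.2
    ⟨.inl n₀, n₀, rfl⟩, HSat_and.2 ⟨HSat_domSmall.2 ?_, HSat_fibresDistinct.2 ?_⟩⟩⟩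
  · have h₁ : #{a // R 0 [a]} = #N := by
      simp only [hP]
      exact Cardinal.mk_range_eq _ Sum.inl_injective
    rw [h₁]
    refine ne_of_lt ?_
    calc #N < κ := Order.lt_succ_of_le (le_max_right _ _)
      _ = #κ.out := (Cardinal.mk_out _).symm
      _ ≤ #(N ⊕ κ.out) := Cardinal.mk_le_of_injective Sum.inr_injective
  · have hfib (n : N) : #{x // R 1 [.inl n, x]} = c n := by
      rw [← hs n]
      refine (Cardinal.mk_congr (Equiv.ofBijective
        (fun q => ⟨.inr q.1, n, q.1, q.2, rfl⟩) ⟨?_, ?_⟩)).symm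
      · intro q q' h
        exact Subtype.ext (Sum.inr_injective (congrArg Subtype.val h))
      · rintro ⟨x, m, q, hq, hx⟩
        simp only [List.cons.injEq, Sum.inl.injEq, and_true] at hx
        obtain ⟨rfl, rfl⟩ := hx
        exact ⟨⟨q, hq⟩, rfl⟩
    rintro _ _ ⟨a, ha⟩ ⟨b, hb⟩ hab
    obtain rfl := List.singleton_injective ha
    obtain rfl := List.singleton_injective hb
    rw [hfib, hfib] at hab
    rw [hc hab]

theorem exists_submodel_of_jump {f : HForm} {M : Type} [Nonempty M] {R : Interp M}
    (h : HModels M R f.jump) : minCard f ≤ #{a // R 0 [a]} ∧ #{a // R 0 [a]} < #M ∧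
      Function.Injective fun p : {a // R 0 [a]} => #{x // R 1 [p.1, x]} := by
  have h' (v) := (HSat_and.1 (h v)).imp_right fun h => (HSat_and.1 h).imp_right HSat_and.1
  obtain ⟨a₀⟩ := ‹Nonempty M›
  obtain ⟨-, h₁, h₂, h₃⟩ := h' fun _ => a₀
  have : Nonempty {a // R 0 [a]} := nonempty_subtype.2 (HSat_domNonempty.1 h₁)
  refine ⟨minCard_le (R := fun r l => R (r + 2) (l.map Subtype.val)) fun v => ?_, ?_, ?_⟩
  · exact (HSat_relativize (Function.Embedding.subtype _) (by simp) (fun _ _ => Iff.rfl) f v).1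
      (h' _).1
  · exact (Cardinal.mk_subtype_le _).lt_of_ne (HSat_domSmall.1 h₂)
  · exact fun p q hpq => Subtype.ext (HSat_fibresDistinct.1 h₃ _ _ p.2 q.2 hpq)

/-- If infinitely many cardinals, indexed injectively by `N`, are all at most `c`, then `c` is at
least the `#N`-th cardinal. -/
theorem preAleph_ord_le_of_injective {N : Type u} {κ c : Cardinal.{u}} (hκ : ℵ₀ ≤ κ)
    (hN : κ ≤ #N) {F : N → Cardinal.{u}} (hF : Function.Injective F) (hc : ∀ n, F n ≤ c) :
    preAleph κ.ord ≤ c := by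
  let g : N → Set.Iio (Order.succ (preAleph.symm c)) := fun n =>
    ⟨preAleph.symm (F n), Order.lt_succ_of_le (preAleph.symm.monotone (hc n))⟩
  have hg : Function.Injective g := fun a b hab =>
    hF (preAleph.symm.injective (congrArg Subtype.val hab))
  have h₁ := Cardinal.lift_mk_le_lift_mk_of_injective hg
  rw [Cardinal.mk_Iio_ordinal, Cardinal.lift_lift] at h₁
  have h₂ : κ ≤ (Order.succ (preAleph.symm c)).card := hN.trans (Cardinal.lift_le.1 (by simpa using h₁))
  have h₃ := (Cardinal.ord_le.2 h₂).lt_of_ne fun h =>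
    (isSuccLimit_ord hκ).isSuccPrelimit.succ_ne _ h.symm
  have := preAleph.monotone (Order.lt_succ_iff.1 h₃)
  rwa [OrderIso.apply_symm_apply] at this

theorem minCard_lt_minCard_jump {f : HForm} (hf : f.IsSentence) (h : HSatisfiable f) :
    minCard f < minCard f.jump := by
  obtain ⟨M, _, R, hM, hR⟩ := exists_model_minCard (h.jump hf)
  obtain ⟨h₁, h₂, -⟩ := exists_submodel_of_jump hR
  exact hM ▸ h₁.trans_lt h₂

theorem preAleph_ord_minCard_le_minCard_jump {f : HForm} (hf : f.IsSentence)
    (h : HSatisfiable f) (hinf : ℵ₀ ≤ minCard f) :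
    preAleph (minCard f).ord ≤ minCard f.jump := by
  obtain ⟨M, _, R, hM, hR⟩ := exists_model_minCard (h.jump hf)
  obtain ⟨h₁, -, h₃⟩ := exists_submodel_of_jump hR
  exact hM ▸ preAleph_ord_le_of_injective hinf h₁ h₃ fun p => Cardinal.mk_subtype_le _

theorem loewenheimBound_iff {κ : Cardinal.{0}} :
    LoewenheimBound κ ↔ ∀ f : HForm, f.IsSentence → HSatisfiable f → minCard f ≤ κ := by
  refine forall₃_congr fun f _ h => ⟨?_, fun hκ => ?_⟩
  · rintro ⟨M, _, R, hM, hR⟩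
    exact (minCard_le hR).trans hM
  · obtain ⟨M, hM, R, h₁, h₂⟩ := exists_model_minCard h
    exact ⟨M, hM, R, h₁ ▸ hκ, h₂⟩

theorem minCard_le_iSup {f : HForm} (hf : f.IsSentence) (h : HSatisfiable f) :
    minCard f ≤ ⨆ g : {g : HForm // g.IsSentence ∧ HSatisfiable g}, minCard g :=
  le_ciSup (f := fun g : {g : HForm // g.IsSentence ∧ HSatisfiable g} => minCard g)
    Cardinal.bddAbove_of_small ⟨f, hf, h⟩

theorem ellI_eq_iSup :
    ellI = ⨆ f : {f : HForm // f.IsSentence ∧ HSatisfiable f}, minCard f :=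
  le_antisymm (csInf_le' (loewenheimBound_iff.2 fun _ => minCard_le_iSup))
    (le_csInf ⟨_, loewenheimBound_iff.2 fun _ => minCard_le_iSup⟩ fun _ hκ =>
      ciSup_le' fun f => loewenheimBound_iff.1 hκ _ f.2.1 f.2.2)

theorem minCard_le_ellI {f : HForm} (hf : f.IsSentence) (h : HSatisfiable f) :
    minCard f ≤ ellI :=
  ellI_eq_iSup ▸ minCard_le_iSup hf h

theorem minCard_lt_ellI {f : HForm} (hf : f.IsSentence) (h : HSatisfiable f) :
    minCard f < ellI :=
  (minCard_lt_minCard_jump hf h).trans_le (minCard_le_ellI hf.jump (h.jump hf))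

theorem aleph0_lt_ellI : ℵ₀ < ellI := by
  obtain ⟨M, _, R, hM, hR⟩ := exists_model_minCard HSatisfiable_infinite
  have := minCard_lt_ellI isSentence_infinite HSatisfiable_infinite
  exact ((HModels_infinite_iff.1 hR).trans_eq hM).trans_lt this

theorem exists_lt_minCard {κ : Cardinal.{0}} (h : κ < ellI) :
    ∃ f : HForm, f.IsSentence ∧ HSatisfiable f ∧ κ < minCard f := by
  by_contra! hcon
  exact h.not_ge (csInf_le' (loewenheimBound_iff.2 hcon))

theorem cof_ord_ellI : ellI.ord.cof = ℵ₀ := by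
  refine le_antisymm ?_ (Ordinal.aleph0_le_cof_iff.2
    (Ordinal.one_lt_cof_iff.2 (isSuccLimit_ord aleph0_lt_ellI.le)))
  by_contra! hlt
  refine (Cardinal.iSup_lt_of_lt_cof_ord (a := ellI)
    (f := fun f : {f : HForm // f.IsSentence ∧ HSatisfiable f} => minCard f)
    (Cardinal.mk_le_aleph0.trans_lt hlt) fun f => minCard_lt_ellI f.2.1 f.2.2).ne ?_
  exact ellI_eq_iSup.symm

theorem preAleph_ord_ellI_le : preAleph ellI.ord ≤ ellI := by
  refine (preAleph_le_of_isSuccPrelimit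
    (isSuccLimit_ord aleph0_lt_ellI.le).isSuccPrelimit).2 fun o ho => ?_
  obtain ⟨f, hf, h, hlt⟩ := exists_lt_minCard
    (max_lt (Cardinal.lt_ord.1 ho) aleph0_lt_ellI)
  have ho' : o ≤ (minCard f).ord :=
    (Cardinal.lt_ord.2 ((le_max_left _ _).trans_lt hlt)).le
  exact ((preAleph_le_preAleph.2 ho').trans (preAleph_ord_minCard_le_minCard_jump hf h
    ((le_max_right _ _).trans hlt.le))).trans (minCard_le_ellI hf.jump (h.jump hf))

theorem aleph_ord_ellI : Cardinal.aleph ellI.ord = ellI := by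
  refine le_antisymm ?_ (le_aleph_ord _)
  rw [aleph_eq_preAleph, Ordinal.isPrincipal_add_iff_add_left_eq_self.1
    (Ordinal.isPrincipal_add_ord aleph0_lt_ellI.le) _ (omega0_lt_ord.2 aleph0_lt_ellI)]
  exact preAleph_ord_ellI_le

/-- The Löwenheim number `ℓ_I` of the Härtig quantifier logic
`L^I` has cofinality `ω` and is a fixed point of the aleph function:
`ℓ_I = ℵ_{ℓ_I}`. -/
theorem ellI_cof_omega_and_aleph_fixed_point :
    (ellI.ord).cof = ℵ₀ ∧ Cardinal.aleph ellI.ord = ellI :=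
  ⟨cof_ord_ellI, aleph_ord_ellI⟩
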